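/- Let β ∈ ℝ, γ > 0, ρ a probability measure on ℝ, and let {μ_t : t ≥ 0} be the free convolution semigroup with canonical triple (β, γ, ρ), i.e. φ_{μ_t}(z) = βt + γt·G_ρ(z). Then for every t ≥ 0, μ_t = δ_{βt} ⊎ Φ[ρ ⊞ σ_{β,γ}^{⊞t}]^{⊎γt}; explicitly, z − F_{μ_t}(z) = βt + γt·G_{ρ ⊞ σ_{βt,γt}}(z) on ℂ⁺. In particular, for every t > 0 the coefficient stripping satisfies J[μ_t] = ρ ⊞ σ_{βt,γt}. -/

import Mathlib

open MeasureTheory Complex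

noncomputable section

/-- The Cauchy transform `G_μ(z) = ∫ 1/(z - x) dμ(x)` of a measure on `ℝ`. -/
def cauchyG (μ : Measure ℝ) (z : ℂ) : ℂ := ∫ x : ℝ, (z - (x : ℂ))⁻¹ ∂μ

/-- The F-transform `F_μ = 1/G_μ`. -/
def Ftr (μ : Measure ℝ) (z : ℂ) : ℂ := (cauchyG μ z)⁻¹

/-- The open upper half-plane `ℂ⁺`. -/
def UHP : Set ℂ := {z : ℂ | 0 < z.im}

/-- The truncated cone `Γ_{α,M} = {z ∈ ℂ⁺ : |Re z| < α · Im z, Im z > M}`. -/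
def tcone (α M : ℝ) : Set ℂ := {z : ℂ | |z.re| < α * z.im ∧ M < z.im}

/-- `φ` is a Voiculescu transform of `μ`: `φ(F_μ(z)) + F_μ(z) = z` on some truncated cone. -/
def IsVT (μ : Measure ℝ) (φ : ℂ → ℂ) : Prop :=
  ∃ α M : ℝ, 0 < α ∧ 0 < M ∧ ∀ z ∈ tcone α M, φ (Ftr μ z) + Ftr μ z = z

/-- `ψ` is a two-state Voiculescu transform of the pair `(μt, μ)`:
`ψ(F_μ(z)) + F_{μt}(z) = z` on some truncated cone. -/
def IsTwoStateVT (μt μ : Measure ℝ) (ψ : ℂ → ℂ) : Prop :=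
  ∃ α M : ℝ, 0 < α ∧ 0 < M ∧ ∀ z ∈ tcone α M, ψ (Ftr μ z) + Ftr μt z = z

/-- `μ` is freely infinitely divisible: some Voiculescu transform `φ` of `μ` is such that
`t·φ` is a Voiculescu transform of a probability measure for every `t ≥ 0`. -/
def IsFID (μ : Measure ℝ) : Prop :=
  ∃ φ : ℂ → ℂ, IsVT μ φ ∧ ∀ t : ℝ, 0 ≤ t →
    ∃ ν : Measure ℝ, IsProbabilityMeasure ν ∧ IsVT ν (fun z => (t : ℂ) * φ z)

/-- The semicircular distribution with mean `β` and variance `γ` (Dirac mass at `β` for `γ = 0`). -/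
def semicircle (β γ : ℝ) : Measure ℝ :=
  if γ = 0 then Measure.dirac β
  else volume.withDensity
    (fun x => ENNReal.ofReal ((2 * Real.pi * γ)⁻¹ * Real.sqrt (4 * γ - (x - β) ^ 2)))

lemma im_le_norm_sub_ofReal (z : ℂ) (x : ℝ) : z.im ≤ ‖z - (x : ℂ)‖ := by
  have h := Complex.abs_im_le_norm (z - (x : ℂ))
  simp only [sub_im, ofReal_im, sub_zero] at h
  exact (le_abs_self _).trans h

lemma sub_ofReal_ne_zero {z : ℂ} (hz : z ∈ UHP) (x : ℝ) : z - (x : ℂ) ≠ 0 :=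
  norm_pos_iff.1 (lt_of_lt_of_le hz (im_le_norm_sub_ofReal z x))

lemma continuous_inv_sub_ofReal {z : ℂ} (hz : z ∈ UHP) :
    Continuous fun x : ℝ => (z - (x : ℂ))⁻¹ :=
  (by fun_prop : Continuous fun x : ℝ => z - (x : ℂ)).inv₀ (sub_ofReal_ne_zero hz)

lemma norm_inv_sub_ofReal_le {z : ℂ} {r : ℝ} (hr : 0 < r) (hz : r ≤ z.im) (x : ℝ) :
    ‖(z - (x : ℂ))⁻¹‖ ≤ r⁻¹ := by
  rw [norm_inv]
  exact inv_anti₀ hr (hz.trans (im_le_norm_sub_ofReal z x))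

lemma integrable_inv_sub_ofReal (μ : Measure ℝ) [IsFiniteMeasure μ] {z : ℂ} (hz : z ∈ UHP) :
    Integrable (fun x : ℝ => (z - (x : ℂ))⁻¹) μ :=
  Integrable.of_bound (continuous_inv_sub_ofReal hz).aestronglyMeasurable z.im⁻¹
    (Filter.Eventually.of_forall (norm_inv_sub_ofReal_le hz le_rfl))

lemma isOpen_UHP : IsOpen UHP := isOpen_lt continuous_const Complex.continuous_im

lemma isPreconnected_UHP : IsPreconnected UHP :=
  (convex_halfSpace_im_gt 0).isPreconnected

lemma differentiableOn_cauchyG (μ : Measure ℝ) [IsFiniteMeasure μ] :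
    DifferentiableOn ℂ (cauchyG μ) UHP := by
  intro z hz
  have hz' : 0 < z.im := hz
  have hball : ∀ w ∈ Metric.ball z (z.im / 2), z.im / 2 ≤ w.im := by
    intro w hw
    have h1 := Complex.abs_im_le_norm (w - z)
    rw [Metric.mem_ball, dist_eq_norm] at hw
    rw [sub_im] at h1
    linarith [(abs_le.1 h1).1]
  have hU : ∀ w ∈ Metric.ball z (z.im / 2), w ∈ UHP := fun w hw =>
    lt_of_lt_of_le (by linarith) (hball w hw)
  have key := hasDerivAt_integral_of_dominated_loc_of_deriv_le (𝕜 := ℂ) (μ := μ)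
    (F := fun w (x : ℝ) => (w - (x : ℂ))⁻¹)
    (F' := fun w (x : ℝ) => -1 / (w - (x : ℂ)) ^ 2) (x₀ := z)
    (s := Metric.ball z (z.im / 2)) (bound := fun _ => ((z.im / 2)⁻¹) ^ 2)
    (Metric.ball_mem_nhds z (by linarith))
    (by
      filter_upwards [isOpen_UHP.mem_nhds hz] with w hw
      exact (continuous_inv_sub_ofReal hw).aestronglyMeasurable)
    (integrable_inv_sub_ofReal μ hz)
    (by
      have : Continuous fun x : ℝ => -1 / (z - (x : ℂ)) ^ 2 :=
        continuous_const.div (by fun_prop) fun x => pow_ne_zero 2 (sub_ofReal_ne_zero hz x)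
      exact this.aestronglyMeasurable)
    (Filter.Eventually.of_forall fun x w hw => by
      have h := norm_inv_sub_ofReal_le (by linarith : 0 < z.im / 2) (hball w hw) x
      rw [norm_div, norm_neg, norm_one, norm_pow, one_div, ← inv_pow, ← norm_inv]
      gcongr)
    (integrable_const _)
    (Filter.Eventually.of_forall fun x w hw => by
      have h := ((hasDerivAt_id w).sub_const (x : ℂ)).inv (sub_ofReal_ne_zero (hU w hw) x)
      exact h)
  exact key.2.differentiableAt.differentiableWithinAt

lemma cauchyG_im_neg (μ : Measure ℝ) [IsProbabilityMeasure μ] {z : ℂ} (hz : z ∈ UHP) :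
    (cauchyG μ z).im < 0 := by
  have hint := integrable_inv_sub_ofReal μ hz
  have him : (cauchyG μ z).im = ∫ x : ℝ, ((z - (x : ℂ))⁻¹).im ∂μ :=
    (integral_im (𝕜 := ℂ) hint).symm
  have hpos : ∀ x : ℝ, 0 < -((z - (x : ℂ))⁻¹).im := by
    intro x
    rw [Complex.inv_im, sub_im, ofReal_im, sub_zero, neg_div, neg_neg]
    exact div_pos hz (Complex.normSq_pos.2 (sub_ofReal_ne_zero hz x))
  have h : 0 < ∫ x : ℝ, -((z - (x : ℂ))⁻¹).im ∂μ := by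
    rw [integral_pos_iff_support_of_nonneg (fun x => (hpos x).le) hint.im.neg]
    have : Function.support (fun x : ℝ => -((z - (x : ℂ))⁻¹).im) = Set.univ :=
      Set.eq_univ_of_forall fun x => (hpos x).ne'
    rw [this, measure_univ]
    exact one_pos
  rw [integral_neg] at h
  rw [him]
  linarith

lemma cauchyG_ne_zero (μ : Measure ℝ) [IsProbabilityMeasure μ] {z : ℂ} (hz : z ∈ UHP) :
    cauchyG μ z ≠ 0 := fun h => by
  have := cauchyG_im_neg μ hz
  rw [h] at this
  simp at this

lemma differentiableOn_Ftr (μ : Measure ℝ) [IsProbabilityMeasure μ] :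
    DifferentiableOn ℂ (Ftr μ) UHP :=
  (differentiableOn_cauchyG μ).inv fun _ hz => cauchyG_ne_zero μ hz

lemma norm_cauchyG_sub_le (μ : Measure ℝ) [IsProbabilityMeasure μ] {u v : ℂ} {r : ℝ}
    (hr : 0 < r) (hu : r ≤ u.im) (hv : r ≤ v.im) :
    ‖cauchyG μ u - cauchyG μ v‖ ≤ (r⁻¹) ^ 2 * ‖u - v‖ := by
  have hu' : u ∈ UHP := lt_of_lt_of_le hr hu
  have hv' : v ∈ UHP := lt_of_lt_of_le hr hv
  rw [cauchyG, cauchyG, ← integral_sub (integrable_inv_sub_ofReal μ hu')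
    (integrable_inv_sub_ofReal μ hv')]
  refine (norm_integral_le_of_norm_le_const (C := (r⁻¹) ^ 2 * ‖u - v‖)
    (Filter.Eventually.of_forall fun x => ?_)).trans (by simp)
  have h : (u - (x : ℂ))⁻¹ - (v - (x : ℂ))⁻¹
      = (u - (x : ℂ))⁻¹ * (v - (x : ℂ))⁻¹ * (v - u) := by
    have := sub_ofReal_ne_zero hu' x
    have := sub_ofReal_ne_zero hv' x
    field_simp
    ring
  rw [h, norm_mul, norm_mul, norm_sub_rev v u, sq]
  have := norm_inv_sub_ofReal_le hr hu x
  have := norm_inv_sub_ofReal_le hr hv x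
  gcongr

lemma im_ge_of_norm_sub_le {z : ℂ} {r y : ℝ} (h : ‖z - I * y‖ ≤ r) : y - r ≤ z.im := by
  have h1 := (Complex.abs_im_le_norm (z - I * y)).trans h
  simp at h1
  linarith [(abs_le.1 h1).1]

lemma abs_re_le_of_norm_sub_le {z : ℂ} {r y : ℝ} (h : ‖z - I * y‖ ≤ r) : |z.re| ≤ r := by
  have h1 := (Complex.abs_re_le_norm (z - I * y)).trans h
  simpa using h1

lemma tendsto_integral_min_div (μ : Measure ℝ) [IsProbabilityMeasure μ] :
    Filter.Tendsto (fun y : ℝ => ∫ x : ℝ, min 4 (2 * |x| / y) ∂μ) Filter.atTop (nhds 0) := by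
  have h := tendsto_integral_filter_of_dominated_convergence (μ := μ) (l := Filter.atTop)
    (F := fun (y : ℝ) (x : ℝ) => min 4 (2 * |x| / y)) (f := fun _ => (0 : ℝ)) (fun _ => (4 : ℝ))
    (Filter.Eventually.of_forall fun y => by
      have : Continuous fun x : ℝ => min 4 (2 * |x| / y) := by fun_prop
      exact this.aestronglyMeasurable)
    (by
      filter_upwards [Filter.eventually_gt_atTop 0] with y hy
      refine Filter.Eventually.of_forall fun x => ?_
      rw [Real.norm_of_nonneg (by positivity)]
      exact min_le_left _ _)
    (integrable_const _)
    (Filter.Eventually.of_forall fun x => by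
      have h1 : Filter.Tendsto (fun y : ℝ => 2 * |x| / y) Filter.atTop (nhds 0) :=
        Filter.Tendsto.const_div_atTop Filter.tendsto_id _
      have h2 := (tendsto_const_nhds (x := (4 : ℝ))).min h1
      simpa using h2)
  simpa using h

lemma norm_mul_cauchyG_sub_one_le (μ : Measure ℝ) [IsProbabilityMeasure μ] {y : ℝ} (hy : 0 < y)
    {z : ℂ} (hz : ‖z - I * y‖ ≤ y / 2) :
    ‖z * cauchyG μ z - 1‖ ≤ ∫ x : ℝ, min 4 (2 * |x| / y) ∂μ := by
  have him : y / 2 ≤ z.im := by linarith [im_ge_of_norm_sub_le hz]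
  have hU : z ∈ UHP := lt_of_lt_of_le (by linarith) him
  have hint := integrable_inv_sub_ofReal μ hU
  have heq : z * cauchyG μ z - 1 = ∫ x : ℝ, (z * (z - (x : ℂ))⁻¹ - 1) ∂μ := by
    rw [integral_sub (hint.const_mul z) (integrable_const _), integral_const_mul, cauchyG]
    simp
  rw [heq]
  refine norm_integral_le_of_norm_le ?_ (Filter.Eventually.of_forall fun x => ?_)
  · have : Continuous fun x : ℝ => min 4 (2 * |x| / y) := by fun_prop
    refine Integrable.of_bound this.aestronglyMeasurable 4 (Filter.Eventually.of_forall fun x => ?_)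
    rw [Real.norm_of_nonneg (by positivity)]
    exact min_le_left _ _
  · have hne := sub_ofReal_ne_zero hU x
    have hd : y / 2 ≤ ‖z - (x : ℂ)‖ := him.trans (im_le_norm_sub_ofReal z x)
    have hx : z * (z - (x : ℂ))⁻¹ - 1 = x / (z - (x : ℂ)) := by field_simp; ring
    have hzn : ‖z‖ ≤ 3 / 2 * y := by
      have h1 := norm_add_le (z - I * y) (I * y)
      rw [sub_add_cancel, norm_mul, norm_I, one_mul, norm_real, Real.norm_of_nonneg hy.le] at h1
      linarith
    have hxn : |x| ≤ ‖z‖ + ‖z - (x : ℂ)‖ := by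
      have h1 := norm_sub_le z (z - (x : ℂ))
      rwa [sub_sub_cancel, norm_real, Real.norm_eq_abs] at h1
    rw [hx, norm_div, norm_real, Real.norm_eq_abs]
    have hdpos : 0 < ‖z - (x : ℂ)‖ := by linarith
    refine le_min ?_ ?_
    · rw [div_le_iff₀ hdpos]; linarith
    · rw [div_le_div_iff₀ hdpos hy]
      nlinarith [abs_nonneg x]

/-- `F_μ(z) - z = o(z)` as `z → ∞` near the imaginary axis. -/
lemma eventually_norm_Ftr_sub_le (μ : Measure ℝ) [IsProbabilityMeasure μ] {η : ℝ} (hη : 0 < η) :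
    ∀ᶠ y : ℝ in Filter.atTop, ∀ z : ℂ, ‖z - I * y‖ ≤ y / 2 → ‖Ftr μ z - z‖ ≤ η * y := by
  have hε : 0 < min (1 / 2) (η / 3) := by positivity
  filter_upwards [(tendsto_integral_min_div μ).eventually_lt_const hε,
    Filter.eventually_gt_atTop 0] with y hy hy0 z hz
  have h := (norm_mul_cauchyG_sub_one_le μ hy0 hz).trans hy.le
  have him : y / 2 ≤ z.im := by linarith [im_ge_of_norm_sub_le hz]
  have hU : z ∈ UHP := lt_of_lt_of_le (by linarith) him
  have hG := cauchyG_ne_zero μ hU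
  have hz0 : z ≠ 0 := by
    rintro rfl
    simp at him
    linarith
  have hzn : ‖z‖ ≤ 3 / 2 * y := by
    have h1 := norm_add_le (z - I * y) (I * y)
    rw [sub_add_cancel, norm_mul, norm_I, one_mul, norm_real, Real.norm_of_nonneg hy0.le] at h1
    linarith
  have hlow : 1 / 2 ≤ ‖z * cauchyG μ z‖ := by
    have h1 := norm_sub_norm_le (1 : ℂ) (z * cauchyG μ z)
    rw [norm_one, norm_sub_rev] at h1
    linarith [h.trans (min_le_left _ _)]
  have heq : Ftr μ z - z = -(z * (z * cauchyG μ z - 1) / (z * cauchyG μ z)) := by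
    rw [Ftr]
    field_simp
    ring
  rw [heq, norm_neg, norm_div, div_le_iff₀ (by linarith), norm_mul]
  have h2 := h.trans (min_le_right _ _)
  calc ‖z‖ * ‖z * cauchyG μ z - 1‖ ≤ (3 / 2 * y) * (η / 3) := by gcongr
    _ = η * y * (1 / 2) := by ring
    _ ≤ _ := by gcongr

lemma mem_tcone_of_norm_sub_le {α M r y : ℝ} (hr : 0 < r) (hr1 : r ≤ 1 / 2) (hr2 : r ≤ α / 3)
    (hy : 0 < y) (hyM : 2 * M < y) {z : ℂ} (hz : ‖z - I * y‖ ≤ r * y) : z ∈ tcone α M := by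
  have h1 := abs_re_le_of_norm_sub_le hz
  have h2 := im_ge_of_norm_sub_le hz
  have h4 : r * y ≤ 1 / 2 * y := by gcongr
  refine ⟨?_, by linarith⟩
  have h6 : 3 * r * (y / 2) ≤ α * z.im :=
    mul_le_mul (by linarith) (by linarith) (by linarith) (by linarith)
  have : 0 < r * y := by positivity
  linarith

/-- The image under `F_μ` of a truncated cone contains points near the imaginary axis. -/
lemma exists_eventually_mem_image_Ftr (μ : Measure ℝ) [IsProbabilityMeasure μ] {α M : ℝ}
    (hα : 0 < α) :
    ∃ δ > 0, ∀ᶠ y : ℝ in Filter.atTop, ∀ w : ℂ, ‖w - I * y‖ ≤ δ * y →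
      ∃ z ∈ tcone α M, Ftr μ z = w := by
  set r : ℝ := min (1 / 2) (α / 3) with hr
  have hr0 : 0 < r := by positivity
  have hr1 : r ≤ 1 / 2 := min_le_left _ _
  have hr2 : r ≤ α / 3 := min_le_right _ _
  refine ⟨r / 2, by positivity, ?_⟩
  filter_upwards [eventually_norm_Ftr_sub_le μ (by positivity : 0 < r / 32),
    Filter.eventually_gt_atTop 0, Filter.eventually_gt_atTop (2 * M)] with y hF hy0 hyM w hw
  have hball : ∀ z ∈ Metric.closedBall w (r / 2 * y), ‖z - I * y‖ ≤ r * y := by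
    intro z hz
    rw [Metric.mem_closedBall, dist_eq_norm] at hz
    calc ‖z - I * y‖ ≤ ‖z - w‖ + ‖w - I * y‖ := norm_sub_le_norm_sub_add_norm_sub _ _ _
      _ ≤ r * y := by linarith
  have hry : r * y ≤ y / 2 := by nlinarith
  have hUHP : ∀ z ∈ Metric.closedBall w (r / 2 * y), z ∈ UHP := fun z hz =>
    lt_of_lt_of_le (by linarith) (im_ge_of_norm_sub_le (hball z hz))
  have hdiff : DiffContOnCl ℂ (Ftr μ) (Metric.ball w (r / 2 * y)) := by
    refine DifferentiableOn.diffContOnCl ?_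
    rw [closure_ball w (by positivity)]
    exact (differentiableOn_Ftr μ).mono hUHP
  have hw0 : w ∈ Metric.closedBall w (r / 2 * y) := Metric.mem_closedBall_self (by positivity)
  have hFw := hF w ((hball w hw0).trans hry)
  have hsphere : ∀ z ∈ Metric.sphere w (r / 2 * y), r / 4 * y ≤ ‖Ftr μ z - Ftr μ w‖ := by
    intro z hz
    have hz' := hF z ((hball z (Metric.sphere_subset_closedBall hz)).trans hry)
    rw [mem_sphere_iff_norm] at hz
    have h1 : ‖z - w‖ ≤ ‖Ftr μ z - Ftr μ w‖ + ‖Ftr μ w - w‖ + ‖Ftr μ z - z‖ := by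
      have h2 : z - w = (Ftr μ z - Ftr μ w) + (Ftr μ w - w) - (Ftr μ z - z) := by ring
      calc ‖z - w‖ = ‖(Ftr μ z - Ftr μ w) + (Ftr μ w - w) - (Ftr μ z - z)‖ := by rw [← h2]
        _ ≤ _ := (norm_sub_le _ _).trans (by gcongr; exact norm_add_le _ _)
    nlinarith
  have hfreq : ∃ᶠ z in nhds w, Ftr μ z ≠ Ftr μ w := by
    intro hev
    have heq := ((differentiableOn_Ftr μ).analyticOnNhd isOpen_UHP).eqOn_of_preconnected_of_eventuallyEq
      analyticOnNhd_const isPreconnected_UHP (hUHP w hw0)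
      (hev.mono fun z hz => not_not.1 hz : Ftr μ =ᶠ[nhds w] fun _ => Ftr μ w)
    obtain ⟨z, hz⟩ := NormedSpace.sphere_nonempty (x := w) (r := r / 2 * y) |>.2 (by positivity)
    have h1 := hsphere z hz
    rw [heq (hUHP z (Metric.sphere_subset_closedBall hz)), sub_self, norm_zero] at h1
    have : 0 < r / 4 * y := by positivity
    linarith
  have hsub := hdiff.ball_subset_image_closedBall (by positivity) hsphere hfreq
  have hmem : w ∈ Metric.ball (Ftr μ w) (r / 4 * y / 2) := by
    rw [Metric.mem_ball, dist_comm, dist_eq_norm]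
    nlinarith
  obtain ⟨z, hz, hzw⟩ := hsub hmem
  exact ⟨z, mem_tcone_of_norm_sub_le hr0 hr1 hr2 hy0 hyM (hball z hz), hzw⟩

lemma integral_sin_sq_div {ω : ℂ} (hω0 : ω ≠ 0) (hω : ‖ω‖ < 1) :
    ∫ θ in (0 : ℝ)..Real.pi, (Real.sin θ : ℂ) ^ 2 * (ω + ω⁻¹ - 2 * (Real.cos θ : ℂ))⁻¹
      = Real.pi * ω / 2 := by
  set k : ℝ → ℂ := fun θ => (ω + ω⁻¹ - 2 * (Real.cos θ : ℂ))⁻¹ with hk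
  have hfac : ∀ θ : ℝ, ω + ω⁻¹ - 2 * (Real.cos θ : ℂ)
      = (1 - ω * exp (θ * I)) * (exp (θ * I) - ω) * (ω * exp (θ * I))⁻¹ := by
    intro θ
    have h0 := exp_ne_zero ((θ : ℂ) * I)
    have h2 : 2 * (Real.cos θ : ℂ) = exp (θ * I) + (exp (θ * I))⁻¹ := by
      rw [← exp_neg, ofReal_cos, Complex.cos]
      ring_nf
    rw [h2]
    field_simp
    ring
  have hne1 : ∀ ζ : ℂ, ‖ζ‖ ≤ 1 → 1 - ω * ζ ≠ 0 := by
    intro ζ hζ h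
    have h1 : ‖ω * ζ‖ = 1 := by rw [← sub_eq_zero.1 h, norm_one]
    rw [norm_mul] at h1
    nlinarith [norm_nonneg ζ, norm_nonneg ω]
  have hne2 : ∀ θ : ℝ, exp (θ * I) - ω ≠ 0 := by
    intro θ h
    rw [← sub_eq_zero.1 h, norm_exp_ofReal_mul_I] at hω
    exact lt_irrefl _ hω
  have hne : ∀ θ : ℝ, ω + ω⁻¹ - 2 * (Real.cos θ : ℂ) ≠ 0 := by
    intro θ
    rw [hfac]
    exact mul_ne_zero (mul_ne_zero (hne1 _ (norm_exp_ofReal_mul_I θ).le) (hne2 θ))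
      (inv_ne_zero (mul_ne_zero hω0 (exp_ne_zero _)))
  have hkc : Continuous k := (by fun_prop : Continuous fun θ : ℝ =>
    ω + ω⁻¹ - 2 * (Real.cos θ : ℂ)).inv₀ hne
  have hcircle : ∫ θ in (0 : ℝ)..2 * Real.pi, k θ * (1 - exp (θ * I) ^ 2) = 2 * Real.pi * ω := by
    have hd : DifferentiableOn ℂ (fun ζ : ℂ => (1 - ζ ^ 2) * ω * (1 - ω * ζ)⁻¹)
        (Metric.closedBall 0 1) := by
      intro ζ hζ
      have := hne1 ζ (by simpa using hζ)
      have h1 : DifferentiableAt ℂ (fun ζ : ℂ => (1 - ω * ζ)⁻¹) ζ :=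
        DifferentiableAt.fun_inv (by fun_prop) this
      have h2 : DifferentiableAt ℂ (fun ζ : ℂ => (1 - ζ ^ 2) * ω) ζ := by fun_prop
      exact (h2.fun_mul h1).differentiableWithinAt
    have h := hd.circleIntegral_sub_inv_smul (w := ω) (by simpa using hω)
    have h1 : 1 - ω ^ 2 ≠ 0 := by simpa [sq] using hne1 ω hω.le
    rw [circleIntegral] at h
    have h2 : ∀ θ : ℝ, deriv (circleMap 0 1) θ • (circleMap 0 1 θ - ω)⁻¹ •
        ((1 - circleMap 0 1 θ ^ 2) * ω * (1 - ω * circleMap 0 1 θ)⁻¹)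
        = I * (k θ * (1 - exp (θ * I) ^ 2)) := by
      intro θ
      have := hne1 _ (norm_exp_ofReal_mul_I θ).le
      have := hne2 θ
      have := exp_ne_zero ((θ : ℂ) * I)
      simp only [hk, hfac, deriv_circleMap, circleMap, ofReal_one, one_mul, zero_add, smul_eq_mul]
      field_simp
    simp only [h2] at h
    rw [intervalIntegral.integral_const_mul] at h
    have h3 : I * (∫ θ in (0 : ℝ)..2 * Real.pi, k θ * (1 - exp (θ * I) ^ 2))
        = I * (2 * Real.pi * ω) := by
      rw [h, smul_eq_mul, show 1 - ω * ω = 1 - ω ^ 2 by ring]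
      field_simp
    exact mul_left_cancel₀ I_ne_zero h3
  have hsplit : ∫ θ in (0 : ℝ)..2 * Real.pi, k θ * (1 - exp (θ * I) ^ 2)
      = ∫ θ in (0 : ℝ)..Real.pi, 4 * ((Real.sin θ : ℂ) ^ 2 * k θ) := by
    have hc : Continuous fun θ : ℝ => k θ * (1 - exp (θ * I) ^ 2) := by fun_prop
    have hc' : Continuous fun θ : ℝ => k θ * (1 - exp (-(θ * I)) ^ 2) := by fun_prop
    have hrefl : ∫ θ in Real.pi..2 * Real.pi, k θ * (1 - exp (θ * I) ^ 2)
        = ∫ θ in (0 : ℝ)..Real.pi, k θ * (1 - exp (-(θ * I)) ^ 2) := by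
      have h := intervalIntegral.integral_comp_sub_left (a := 0) (b := Real.pi)
        (fun θ : ℝ => k θ * (1 - exp (θ * I) ^ 2)) (2 * Real.pi)
      rw [show 2 * Real.pi - Real.pi = Real.pi by ring, sub_zero] at h
      rw [← h]
      refine intervalIntegral.integral_congr fun θ _ => ?_
      have h1 : exp (((2 * Real.pi - θ : ℝ) : ℂ) * I) = exp (-(θ * I)) := by
        rw [← exp_periodic (-(θ * I))]
        congr 1
        push_cast
        ring
      simp only [hk, h1, Real.cos_two_pi_sub]
    rw [← intervalIntegral.integral_add_adjacent_intervals (hc.intervalIntegrable 0 Real.pi)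
      (hc.intervalIntegrable _ _), hrefl, ← intervalIntegral.integral_add
      (hc.intervalIntegrable _ _) (hc'.intervalIntegrable _ _)]
    refine intervalIntegral.integral_congr fun θ _ => ?_
    have h1 : (Real.sin θ : ℂ) ^ 2 = -(exp (θ * I) - exp (-(θ * I))) ^ 2 / 4 := by
      rw [ofReal_sin, Complex.sin, div_pow, mul_pow, I_sq, neg_mul]
      ring
    have h2 : exp (θ * I) * exp (-(θ * I)) = 1 := by rw [← exp_add]; simp
    simp only [h1]
    linear_combination (-2 * k θ) * h2
  rw [hsplit, intervalIntegral.integral_const_mul] at hcircle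
  linear_combination hcircle / 4

lemma cauchyG_semicircle {b c : ℝ} (hc : 0 ≤ c) {w : ℂ} (hw0 : w ≠ 0) (hw : c < ‖w‖ ^ 2)
    (hz : b + c * w⁻¹ + w ∈ UHP) :
    cauchyG (semicircle b c) (b + c * w⁻¹ + w) = w⁻¹ := by
  rcases hc.eq_or_lt with rfl | hc
  · simp [cauchyG, semicircle]
  set z : ℂ := b + c * w⁻¹ + w with hzdef
  set s : ℝ := √c with hsdef
  have hs : 0 < s := Real.sqrt_pos.2 hc
  have hs2 : s ^ 2 = c := Real.sq_sqrt hc.le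
  have hsw : s < ‖w‖ := lt_of_pow_lt_pow_left₀ 2 (norm_nonneg w) (by rwa [hs2])
  have hsC : (s : ℂ) ≠ 0 := ofReal_ne_zero.2 hs.ne'
  have hsC2 : (c : ℂ) = (s : ℂ) ^ 2 := by rw [← hs2, ofReal_pow]
  set g : ℝ → ℂ := fun x => ((2 * Real.pi * c)⁻¹ * √(4 * c - (x - b) ^ 2) : ℝ) • (z - (x : ℂ))⁻¹
    with hg
  have hgc : Continuous g :=
    (by fun_prop : Continuous fun x : ℝ => (2 * Real.pi * c)⁻¹ * √(4 * c - (x - b) ^ 2)).smul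
      (continuous_inv_sub_ofReal hz)
  have h1 : cauchyG (semicircle b c) z = ∫ x, g x := by
    rw [cauchyG, semicircle, if_neg hc.ne', integral_withDensity_eq_integral_toReal_smul
      (by fun_prop) (Filter.Eventually.of_forall fun _ => ENNReal.ofReal_lt_top)]
    refine integral_congr_ae (Filter.Eventually.of_forall fun x => ?_)
    simp only [hg]
    rw [ENNReal.toReal_ofReal (by positivity)]
  have h2 : ∫ x, g x = ∫ x in (b - 2 * s)..(b + 2 * s), g x := by
    rw [intervalIntegral.integral_of_le (by linarith), setIntegral_eq_integral_of_forall_compl_eq_zero]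
    intro x hx
    have : 4 * c - (x - b) ^ 2 ≤ 0 := by
      rw [Set.mem_Ioc, not_and_or, not_lt, not_le] at hx
      rcases hx with hx | hx <;> nlinarith
    simp [hg, Real.sqrt_eq_zero_of_nonpos this]
  have h3 := intervalIntegral.integral_deriv_smul_comp (a := 0) (b := Real.pi)
    (f := fun θ => b + 2 * s * Real.cos θ) (f' := fun θ => 2 * s * (-Real.sin θ)) (g := g)
    (fun θ _ => ((Real.hasDerivAt_cos θ).const_mul (2 * s)).const_add b)
    (by fun_prop) hgc
  rw [h1, h2]
  simp only [Real.cos_zero, Real.cos_pi, Function.comp] at h3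
  rw [show b + 2 * s * 1 = b + 2 * s by ring, show b + 2 * s * -1 = b - 2 * s by ring,
    intervalIntegral.integral_symm (b - 2 * s)] at h3
  have hω := integral_sin_sq_div (ω := s * w⁻¹) (mul_ne_zero hsC (inv_ne_zero hw0)) (by
    rw [norm_mul, norm_inv, norm_real, Real.norm_of_nonneg hs.le, ← div_eq_mul_inv]
    exact (div_lt_one (hs.trans hsw)).2 hsw)
  have h4 : ∀ θ ∈ Set.uIcc 0 Real.pi, (2 * s * (-Real.sin θ)) • g (b + 2 * s * Real.cos θ)
      = (-(2 / (Real.pi * s)) : ℂ) * ((Real.sin θ : ℂ) ^ 2 *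
        (s * w⁻¹ + (s * w⁻¹)⁻¹ - 2 * (Real.cos θ : ℂ))⁻¹) := by
    intro θ hθ
    rw [Set.uIcc_of_le Real.pi_pos.le] at hθ
    have hsin := Real.sin_nonneg_of_mem_Icc hθ
    have h5 : √(4 * c - (b + 2 * s * Real.cos θ - b) ^ 2) = 2 * s * Real.sin θ := by
      rw [← hs2, show 4 * s ^ 2 - (b + 2 * s * Real.cos θ - b) ^ 2 = (2 * s * Real.sin θ) ^ 2 by
        rw [mul_pow, Real.sin_sq]; ring]
      exact Real.sqrt_sq (by positivity)
    have h6 : z - ((b + 2 * s * Real.cos θ : ℝ) : ℂ)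
        = s * (s * w⁻¹ + (s * w⁻¹)⁻¹ - 2 * (Real.cos θ : ℂ)) := by
      rw [hzdef, hsC2]
      push_cast
      field_simp
      ring
    have hpi : (Real.pi : ℂ) ≠ 0 := ofReal_ne_zero.2 Real.pi_ne_zero
    simp only [hg, h5, h6, mul_inv, real_smul]
    push_cast
    rw [hsC2]
    field_simp
  rw [intervalIntegral.integral_congr h4, intervalIntegral.integral_const_mul, hω] at h3
  have hpi : (Real.pi : ℂ) ≠ 0 := ofReal_ne_zero.2 Real.pi_ne_zero
  rw [← neg_eq_iff_eq_neg] at h3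
  rw [← h3]
  field_simp

lemma I_mul_mem_tcone {α M y : ℝ} (hα : 0 < α) (hy0 : 0 < y) (hy : M < y) :
    I * (y : ℂ) ∈ tcone α M := by
  constructor
  · simpa using mul_pos hα hy0
  · simpa using hy

/-- For the free convolution semigroup `{μ t}` with canonical triple
`(β, γ, ρ)` (i.e. `φ_{μ_t}(z) = βt + γt·G_ρ(z)`), and `ν t = ρ ⊞ σ_{βt,γt}`, one has
`z − F_{μ_t}(z) = βt + γt·G_{ν t}(z)` on `ℂ⁺`; in particular `J[μ_t] = ρ ⊞ σ_{βt,γt}`. -/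
theorem stmt0
    (β γ : ℝ) (hγ : 0 < γ)
    (ρ : Measure ℝ) (hρ : IsProbabilityMeasure ρ)
    (μ : ℝ → Measure ℝ) (hμprob : ∀ t : ℝ, 0 ≤ t → IsProbabilityMeasure (μ t))
    (hμVT : ∀ t : ℝ, 0 ≤ t →
      IsVT (μ t) (fun z => ((β * t : ℝ) : ℂ) + ((γ * t : ℝ) : ℂ) * cauchyG ρ z))
    (ν : ℝ → Measure ℝ) (hνprob : ∀ t : ℝ, 0 ≤ t → IsProbabilityMeasure (ν t))
    (hν : ∀ t : ℝ, 0 ≤ t → ∃ φρ φσ : ℂ → ℂ,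
      IsVT ρ φρ ∧ IsVT (semicircle (β * t) (γ * t)) φσ ∧
      IsVT (ν t) (fun z => φρ z + φσ z)) :
    ∀ t : ℝ, 0 ≤ t → ∀ z ∈ UHP,
      z - Ftr (μ t) z = ((β * t : ℝ) : ℂ) + ((γ * t : ℝ) : ℂ) * cauchyG (ν t) z := by
  intro t ht
  set b : ℝ := β * t
  set c : ℝ := γ * t
  have hc : 0 ≤ c := by positivity
  have := hμprob t ht
  have := hνprob t ht
  obtain ⟨αμ, Mμ, hαμ, -, hμ⟩ := hμVT t ht
  obtain ⟨φρ, φσ, ⟨αρ, Mρ, hαρ, -, hφρ⟩, ⟨ασ, Mσ, hασ, -, hφσ⟩, ⟨αν, Mν, hαν, -, hφν⟩⟩ := hν t ht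
  obtain ⟨δ, hδ, hρim⟩ := exists_eventually_mem_image_Ftr ρ (M := Mρ) hαρ
  set r : ℝ := min (1 / 2) (ασ / 3)
  have hr0 : 0 < r := by positivity
  have hη : 0 < min δ (min (1 / 4) (r / 2)) := by positivity
  have hev : ∀ᶠ y : ℝ in Filter.atTop, I * (y : ℂ) - Ftr (μ t) (I * y)
      = (b : ℂ) + (c : ℂ) * cauchyG (ν t) (I * y) := by
    filter_upwards [hρim, eventually_norm_Ftr_sub_le (ν t) hη,
      eventually_norm_Ftr_sub_le (μ t) (by norm_num : (0 : ℝ) < 1 / 2),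
      Filter.eventually_gt_atTop 0, Filter.eventually_gt_atTop 2, Filter.eventually_gt_atTop Mμ,
      Filter.eventually_gt_atTop Mν, Filter.eventually_gt_atTop (2 * Mσ),
      Filter.eventually_gt_atTop (4 * c), Filter.eventually_gt_atTop ((|b| + c) / (r / 2))]
      with y hρy hνy hμy hy0 hy2 hyμ hyν hyσ hyc hyb
    have hzz : ‖I * (y : ℂ) - I * y‖ ≤ y / 2 := by simpa using (half_pos hy0).le
    have hzU : I * (y : ℂ) ∈ UHP := by simpa [UHP] using hy0
    set z : ℂ := I * (y : ℂ) with hz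
    have hzim : z.im = y := by simp [hz]
    have hF := hνy z hzz
    have hGν := cauchyG_ne_zero (ν t) hzU
    set w : ℂ := Ftr (ν t) z with hw
    have hwinv : w⁻¹ = cauchyG (ν t) z := by rw [hw, Ftr, inv_inv]
    have hw0 : w ≠ 0 := inv_ne_zero hGν
    obtain ⟨z₁, hz₁, hz₁w⟩ := hρy w (hF.trans (by gcongr; exact min_le_left _ _))
    have hF1 : ‖w - z‖ ≤ 1 / 4 * y := hF.trans (by
      gcongr; exact (min_le_right _ _).trans (min_le_left _ _))
    have hF2 : ‖w - z‖ ≤ r / 2 * y := hF.trans (by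
      gcongr; exact (min_le_right _ _).trans (min_le_right _ _))
    have hwn : y / 2 ≤ ‖w‖ := by
      have h1 := im_ge_of_norm_sub_le hF1
      have h2 := (le_abs_self _).trans (Complex.abs_im_le_norm w)
      linarith
    have hz₂ : ‖(b + c * w⁻¹ + w : ℂ) - I * y‖ ≤ r * y := by
      have h1 : ‖w⁻¹‖ ≤ 1 := by
        rw [norm_inv]
        exact inv_le_one_of_one_le₀ (by linarith)
      rw [div_lt_iff₀ (by positivity)] at hyb
      calc ‖(b + c * w⁻¹ + w : ℂ) - I * y‖ = ‖(b : ℂ) + c * w⁻¹ + (w - z)‖ := by rw [hz]; ring_nf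
        _ ≤ ‖(b : ℂ)‖ + ‖(c : ℂ) * w⁻¹‖ + ‖w - z‖ := norm_add₃_le
        _ ≤ |b| + c * 1 + r / 2 * y := by
          rw [norm_mul, norm_real, norm_real, Real.norm_of_nonneg hc, Real.norm_eq_abs]
          gcongr
        _ ≤ r * y := by linarith
    have hcone : (b + c * w⁻¹ + w : ℂ) ∈ tcone ασ Mσ :=
      mem_tcone_of_norm_sub_le hr0 (min_le_left _ _) (min_le_right _ _) hy0 hyσ hz₂
    have hconeU : (b + c * w⁻¹ + w : ℂ) ∈ UHP :=
      (mem_tcone_of_norm_sub_le (M := 0) hr0 (min_le_left _ _) (min_le_right _ _) hy0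
        (by linarith) hz₂).2
    have hσ : Ftr (semicircle b c) (b + c * w⁻¹ + w) = w := by
      rw [Ftr, cauchyG_semicircle hc hw0 (by nlinarith) hconeU, inv_inv]
    have e1 := hφρ z₁ hz₁
    have e2 := hφσ _ hcone
    have e3 := hφν z (I_mul_mem_tcone hαν hy0 hyν)
    rw [hz₁w] at e1
    rw [hσ] at e2
    rw [← hw] at e3
    simp only at e3
    have hz₁eq : z₁ = z - b - c * cauchyG (ν t) z := by
      rw [← hwinv]
      linear_combination e3 - e1 - e2
    have hGz₁ : cauchyG ρ z₁ = cauchyG (ν t) z := by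
      rw [← hwinv, ← hz₁w, Ftr, inv_inv]
    have hz₁im : y / 2 ≤ z₁.im := by
      have h1 := cauchyG_im_neg (ν t) hzU
      have h2 : z₁.im = y - c * (cauchyG (ν t) z).im := by
        rw [hz₁eq]
        simp [hzim]
      nlinarith
    have e4 := hμ z (I_mul_mem_tcone hαμ hy0 hyμ)
    set u : ℂ := Ftr (μ t) z with hu
    have huim : y / 2 ≤ u.im := by
      have h1 := hμy z hzz
      have h2 := im_ge_of_norm_sub_le h1
      linarith
    have hdiff := norm_cauchyG_sub_le ρ (by linarith : 0 < y / 2) huim hz₁im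
    have heq : u - z₁ = -(c * (cauchyG ρ u - cauchyG ρ z₁)) := by
      rw [hGz₁, hz₁eq]
      linear_combination e4
    have huz : u = z₁ := by
      by_contra hne
      have hpos : 0 < ‖u - z₁‖ := norm_pos_iff.2 (sub_ne_zero.2 hne)
      have h1 : ‖u - z₁‖ ≤ c * (((y / 2)⁻¹) ^ 2 * ‖u - z₁‖) := by
        conv_lhs => rw [heq]
        rw [norm_neg, norm_mul, norm_real, Real.norm_of_nonneg hc]
        gcongr
      have h2 : c * ((y / 2)⁻¹) ^ 2 < 1 := by
        rw [inv_pow, ← div_eq_mul_inv, div_lt_one (by positivity)]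
        nlinarith
      nlinarith
    rw [huz, hz₁eq]
    ring
  obtain ⟨Y, hY⟩ := Filter.eventually_atTop.1 (hev.and (Filter.eventually_gt_atTop 0))
  have hYpos : 0 < Y := (hY Y le_rfl).2
  have hf : AnalyticOnNhd ℂ (fun z => z - Ftr (μ t) z) UHP :=
    (differentiableOn_id.sub (differentiableOn_Ftr (μ t))).analyticOnNhd isOpen_UHP
  have hg : AnalyticOnNhd ℂ (fun z => (b : ℂ) + (c : ℂ) * cauchyG (ν t) z) UHP :=
    (((differentiableOn_cauchyG (ν t)).const_mul _).const_add _).analyticOnNhd isOpen_UHP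
  refine hf.eqOn_of_preconnected_of_frequently_eq hg isPreconnected_UHP
    (z₀ := I * Y) (by simpa [UHP] using hYpos) ?_
  have htend : Filter.Tendsto (fun y : ℝ => I * (y : ℂ)) (nhdsWithin Y (Set.Ioi Y))
      (nhdsWithin (I * Y) {I * (Y : ℂ)}ᶜ) := by
    refine tendsto_nhdsWithin_iff.2 ⟨?_, ?_⟩
    · exact ((by fun_prop : Continuous fun y : ℝ => I * (y : ℂ)).tendsto Y).mono_left nhdsWithin_le_nhds
    · filter_upwards [self_mem_nhdsWithin] with y hy h
      have h1 : y = Y := by simpa using h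
      exact (ne_of_gt hy) h1
  refine htend.frequently (Filter.Eventually.frequently ?_)
  filter_upwards [self_mem_nhdsWithin] with y hy
  exact (hY y (le_of_lt hy)).1
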